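/- arXiv:2211.16595 — 2 statements merged into one kernel-verified Lean document; each statement's English description precedes it below -/
import Mathlib

section
/- Let p be a prime, n ≥ 2 an integer, and β = (β_1,…,β_{n−1}) a composition of length n−1 with β_1 ≥ 2, β_i ≥ 1 for all i, and β_1 + β_2 + ⋯ + β_{n−1} > n. Let β' = (β_1−2, β_2−1, …, β_{n−1}−1). Then g_β(p) ≥ p^{n−2} · #S_{β'}, where #S_{β'} denotes the number of subring matrices of size n with diagonal (p^{β_1−2}, p^{β_2−1}, …, p^{β_{n−1}−1}, 1). -/
/-- `v` lies in the ℤ-span of the columns of the square integer matrix `A`. -/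
def InColSpan {n : ℕ} (A : Matrix (Fin n) (Fin n) ℤ) (v : Fin n → ℤ) : Prop :=
  ∃ x : Fin n → ℤ, A.mulVec x = v

/-- `A` is a subring matrix: upper triangular in Hermite normal form (positive
diagonal, `0 ≤ A i j < A i i` for `i < j`), the all-ones vector lies in the
ℤ-span of the columns, and the componentwise product of any two columns lies in
the ℤ-span of the columns. -/
def IsSubringMatrix {n : ℕ} (A : Matrix (Fin n) (Fin n) ℤ) : Prop :=
  (∀ i j : Fin n, j < i → A i j = 0) ∧
  (∀ i : Fin n, 0 < A i i) ∧
  (∀ i j : Fin n, i < j → 0 ≤ A i j ∧ A i j < A i i) ∧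
  InColSpan A (fun _ => 1) ∧
  (∀ j k : Fin n, InColSpan A (fun i => A i j * A i k))

/-- `A` is an irreducible subring matrix for the prime `p` with diagonal
`(p ^ α 0, …, p ^ α (n-1), 1)`: a subring matrix with the prescribed diagonal,
whose last column has all entries equal to `1`, and all of whose off-diagonal
entries away from the last column are divisible by `p`. -/
def IsIrreducibleSubringMatrix (p : ℕ) {n : ℕ} (α : Fin n → ℕ)
    (A : Matrix (Fin (n + 1)) (Fin (n + 1)) ℤ) : Prop :=
  IsSubringMatrix A ∧
  (∀ i : Fin n, A i.castSucc i.castSucc = (p : ℤ) ^ α i) ∧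
  A (Fin.last n) (Fin.last n) = 1 ∧
  (∀ i : Fin (n + 1), A i (Fin.last n) = 1) ∧
  (∀ i j : Fin n, i < j → (p : ℤ) ∣ A i.castSucc j.castSucc)

/-- `gComp p α` : the number of irreducible subring matrices with diagonal
`(p ^ α 0, …, p ^ α (n-1), 1)`. -/
noncomputable def gComp (p : ℕ) {n : ℕ} (α : Fin n → ℕ) : ℕ :=
  Nat.card {A : Matrix (Fin (n + 1)) (Fin (n + 1)) ℤ // IsIrreducibleSubringMatrix p α A}

/-- `gNum p n e` : the number of irreducible subring matrices of size `n` with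
determinant `p ^ e` (so `gNum p 1 0 = 1` and `gNum p 1 e = 0` for `e ≥ 1`). -/
noncomputable def gNum (p : ℕ) : ℕ → ℕ → ℕ
  | 0, _ => 0
  | m + 1, e =>
      Nat.card {A : Matrix (Fin (m + 1)) (Fin (m + 1)) ℤ //
        (∃ α : Fin m → ℕ, (∀ i, 1 ≤ α i) ∧ IsIrreducibleSubringMatrix p α A) ∧
        A.det = (p : ℤ) ^ e}

lemma inColSpan_iff_mem_range {n : ℕ} (A : Matrix (Fin n) (Fin n) ℤ) (v : Fin n → ℤ) :
    InColSpan A v ↔ v ∈ LinearMap.range A.mulVecLin := Iff.rfl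

lemma col_mem_range {n : ℕ} (A : Matrix (Fin n) (Fin n) ℤ) (j : Fin n) :
    (fun i => A i j) ∈ LinearMap.range A.mulVecLin :=
  ⟨Pi.single j 1, by ext i; simp⟩

/-- A vector in the column span of an upper-triangular matrix, each of whose entries is smaller in
absolute value than the corresponding diagonal entry, vanishes. -/
lemma eq_zero_of_inColSpan {n : ℕ} {A : Matrix (Fin n) (Fin n) ℤ}
    (hA : ∀ i j : Fin n, j < i → A i j = 0) {v : Fin n → ℤ} (hv : InColSpan A v)
    (hlt : ∀ i, |v i| < A i i) : v = 0 := by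
  obtain ⟨x, rfl⟩ := hv
  suffices h : ∀ i, x i = 0 by
    rw [show x = 0 from funext h, Matrix.mulVec_zero]
  intro i
  induction i using WellFoundedGT.induction with
  | ind i ih =>
    have h1 : A.mulVec x i = A i i * x i := by
      rw [Matrix.mulVec, dotProduct]
      refine Finset.sum_eq_single i (fun j _ hj => ?_) (by simp)
      rcases lt_or_gt_of_ne hj with h | h
      · rw [hA i j h, zero_mul]
      · rw [ih j h, mul_zero]
    have h2 := hlt i
    have h3 : A i i * x i = 0 := Int.eq_zero_of_abs_lt_dvd ⟨x i, rfl⟩ (h1 ▸ h2)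
    have h4 : 0 < A i i := (abs_nonneg _).trans_lt h2
    exact (mul_eq_zero.mp h3).resolve_left h4.ne'

/-- The subring matrix attached to the lattice generated by `1` and the vectors
`p * (a_j + d_j * a_0)`, where `a_j` is the `j`-th column of `A`. -/
def shiftMatrix {k : ℕ} (p : ℤ) (d : Fin (k + 1) → ℤ)
    (A : Matrix (Fin (k + 2)) (Fin (k + 2)) ℤ) : Matrix (Fin (k + 2)) (Fin (k + 2)) ℤ :=
  Matrix.of fun i => Fin.snoc (α := fun _ => ℤ) (fun j => p * (A i j.castSucc + d j * A i 0)) 1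

section shiftMatrix

variable {k : ℕ} {p : ℤ} {d : Fin (k + 1) → ℤ} {A : Matrix (Fin (k + 2)) (Fin (k + 2)) ℤ}

@[simp] lemma shiftMatrix_castSucc (i : Fin (k + 2)) (j : Fin (k + 1)) :
    shiftMatrix p d A i j.castSucc = p * (A i j.castSucc + d j * A i 0) := by
  simp [shiftMatrix]

@[simp] lemma shiftMatrix_last (i : Fin (k + 2)) :
    shiftMatrix p d A i (Fin.last (k + 1)) = 1 := by
  simp [shiftMatrix]

lemma sq_smul_mem_range_shiftMatrix (hd : d 0 = p - 1)
    (htri : ∀ i j : Fin (k + 2), j < i → A i j = 0)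
    (hlast : A (Fin.last (k + 1)) (Fin.last (k + 1)) = 1)
    {v : Fin (k + 2) → ℤ} (hv : v ∈ LinearMap.range A.mulVecLin) (h0 : v (Fin.last (k + 1)) = 0) :
    p ^ 2 • v ∈ LinearMap.range (shiftMatrix p d A).mulVecLin := by
  obtain ⟨x, rfl⟩ := hv
  have hx : x (Fin.last (k + 1)) = 0 := by
    simpa [Matrix.mulVec, dotProduct, Fin.sum_univ_castSucc, hlast,
      htri _ _ (Fin.castSucc_lt_last _)] using h0
  have hsum : p ^ 2 • A.mulVecLin x =
      ∑ j : Fin (k + 1), x j.castSucc • p ^ 2 • fun i => A i j.castSucc := by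
    ext i
    simp only [Matrix.mulVecLin_apply, Matrix.mulVec, dotProduct,
      Fin.sum_univ_castSucc (n := k + 1), hx, Pi.smul_apply, Finset.sum_apply, smul_eq_mul,
      mul_zero, add_zero, Finset.mul_sum]
    exact Finset.sum_congr rfl fun j _ => by ring
  rw [hsum]
  refine Submodule.sum_mem _ fun j _ => Submodule.smul_mem _ _ ?_
  have hj := col_mem_range (shiftMatrix p d A) j.castSucc
  have hz := col_mem_range (shiftMatrix p d A) (Fin.castSucc 0)
  convert Submodule.sub_mem _ (Submodule.smul_mem _ p hj) (Submodule.smul_mem _ (d j) hz) using 1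
  ext i
  simp only [Pi.smul_apply, Pi.sub_apply, smul_eq_mul, shiftMatrix_castSucc, hd]
  rw [Fin.castSucc_zero]
  ring

lemma mul_col_mem_range_shiftMatrix (hd : d 0 = p - 1) (hA : IsSubringMatrix A)
    (hlast : A (Fin.last (k + 1)) (Fin.last (k + 1)) = 1) (j l : Fin (k + 1)) :
    (fun i => shiftMatrix p d A i j.castSucc * shiftMatrix p d A i l.castSucc) ∈
      LinearMap.range (shiftMatrix p d A).mulVecLin := by
  obtain ⟨htri, -, -, -, hmul⟩ := hA
  have hm : ∀ a b, (fun i => A i a * A i b) ∈ LinearMap.range A.mulVecLin := hmul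
  have key : (fun i => (A i j.castSucc + d j * A i 0) * (A i l.castSucc + d l * A i 0)) ∈
      LinearMap.range A.mulVecLin := by
    convert Submodule.add_mem _
      (Submodule.add_mem _ (hm j.castSucc l.castSucc) (Submodule.smul_mem _ (d l) (hm j.castSucc 0)))
      (Submodule.add_mem _ (Submodule.smul_mem _ (d j) (hm 0 l.castSucc))
        (Submodule.smul_mem _ (d j * d l) (hm 0 0))) using 1
    ext i
    simp only [Pi.add_apply, Pi.smul_apply, smul_eq_mul]
    ring
  convert sq_smul_mem_range_shiftMatrix (p := p) hd htri hlast key ?_ using 1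
  · ext i
    simp only [shiftMatrix_castSucc, Pi.smul_apply, smul_eq_mul]
    ring
  · simp [htri _ _ (Fin.castSucc_lt_last _), htri _ _ (Fin.last_pos)]

end shiftMatrix

lemma isIrreducibleSubringMatrix_shiftMatrix {p k : ℕ} (hp : 1 < p) {β : Fin (k + 1) → ℕ}
    (hpos : ∀ i, 1 ≤ β i) (hfirst : 2 ≤ β 0) {d : Fin (k + 1) → ℤ} (hd0 : d 0 = p - 1)
    (hd : ∀ i, 0 ≤ d i ∧ d i < p) {A : Matrix (Fin (k + 2)) (Fin (k + 2)) ℤ}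
    (hA : IsSubringMatrix A)
    (hdiag : ∀ i : Fin (k + 1), A i.castSucc i.castSucc =
      (p : ℤ) ^ (if i.val = 0 then β i - 2 else β i - 1))
    (hlast : A (Fin.last (k + 1)) (Fin.last (k + 1)) = 1) :
    IsIrreducibleSubringMatrix p β (shiftMatrix p d A) := by
  have hp' : (1 : ℤ) < p := by exact_mod_cast hp
  have hA' := hA
  obtain ⟨htri, hApos, hbd, -, -⟩ := hA'
  have hBdiag : ∀ i : Fin (k + 1),
      shiftMatrix (p : ℤ) d A i.castSucc i.castSucc = (p : ℤ) ^ β i := by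
    intro i
    rw [shiftMatrix_castSucc, hdiag]
    rcases eq_or_ne i 0 with rfl | hi
    · have h := hdiag 0
      rw [Fin.castSucc_zero] at h ⊢
      rw [h, hd0]
      obtain ⟨b, hb⟩ := Nat.exists_eq_add_of_le' hfirst
      simp only [hb, Fin.val_zero, if_true, Nat.add_sub_cancel]
      ring
    · have hi' : i.val ≠ 0 := fun h => hi (Fin.ext h)
      rw [htri _ 0 (Fin.pos_of_ne_zero (Fin.castSucc_ne_zero_iff.mpr hi)), if_neg hi']
      obtain ⟨b, hb⟩ := Nat.exists_eq_add_of_le' (hpos i)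
      rw [hb, Nat.add_sub_cancel]
      ring
  have hB0 : ∀ j : Fin (k + 1), 0 ≤ shiftMatrix (p : ℤ) d A 0 j.castSucc := fun j => by
    rw [shiftMatrix_castSucc]
    have h1 : 0 ≤ A 0 j.castSucc := by
      rcases eq_or_ne j 0 with rfl | hj
      · exact (hApos 0).le
      · have hlt : 0 < j.castSucc := Fin.pos_of_ne_zero (Fin.castSucc_ne_zero_iff.mpr hj)
        exact (hbd 0 j.castSucc hlt).1
    have := (hApos 0).le
    have := (hd j).1
    positivity
  refine ⟨⟨?_, ?_, ?_, ?_, ?_⟩, hBdiag, shiftMatrix_last _, shiftMatrix_last, ?_⟩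
  · intro i j hij
    induction j using Fin.lastCases with
    | last => exact absurd hij (Fin.le_last i).not_gt
    | cast j => rw [shiftMatrix_castSucc, htri i _ hij, htri i 0 ((Fin.zero_le _).trans_lt hij)]; simp
  · intro i
    induction i using Fin.lastCases with
    | last => simp
    | cast i => rw [hBdiag]; positivity
  · intro i j hij
    induction j using Fin.lastCases with
    | last =>
      obtain ⟨i, rfl⟩ := Fin.exists_castSucc_eq.mpr hij.ne
      rw [shiftMatrix_last, hBdiag]
      exact ⟨zero_le_one, one_lt_pow₀ hp' (by have := hpos i; omega)⟩
    | cast j =>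
      rcases eq_or_ne i 0 with rfl | hi
      · refine ⟨hB0 j, ?_⟩
        have h1 := (hbd 0 j.castSucc hij).2
        have h0 := shiftMatrix_castSucc (p := (p : ℤ)) (d := d) (A := A) 0 0
        rw [Fin.castSucc_zero, hd0] at h0
        rw [h0, shiftMatrix_castSucc]
        have h2 := (hd j).2
        have h3 := hApos 0
        apply mul_lt_mul_of_pos_left _ (by omega)
        nlinarith
      · obtain ⟨i', rfl⟩ := Fin.exists_castSucc_eq.mpr (hij.trans (Fin.castSucc_lt_last j)).ne
        have h0 : A i'.castSucc 0 = 0 := htri _ _ (Fin.pos_of_ne_zero hi)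
        have h1 := hbd _ _ hij
        rw [shiftMatrix_castSucc, shiftMatrix_castSucc, h0, mul_zero, add_zero, mul_zero, add_zero]
        exact ⟨mul_nonneg (by omega) h1.1, mul_lt_mul_of_pos_left h1.2 (by omega)⟩
  · rw [inColSpan_iff_mem_range]
    simpa using col_mem_range (shiftMatrix (p : ℤ) d A) (Fin.last (k + 1))
  · intro j l
    rw [inColSpan_iff_mem_range]
    induction j using Fin.lastCases with
    | last => simpa using col_mem_range (shiftMatrix (p : ℤ) d A) l
    | cast j =>
      induction l using Fin.lastCases with
      | last => simpa using col_mem_range (shiftMatrix (p : ℤ) d A) j.castSucc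
      | cast l => exact mul_col_mem_range_shiftMatrix hd0 hA hlast j l
  · intro i j _
    rw [shiftMatrix_castSucc]
    exact dvd_mul_right _ _

/-- A subring matrix with bottom right entry `1` is determined by its other columns. -/
lemma IsSubringMatrix.ext_of_castSucc {m : ℕ} {A B : Matrix (Fin (m + 1)) (Fin (m + 1)) ℤ}
    (hA : IsSubringMatrix A) (hB : IsSubringMatrix B)
    (hAlast : A (Fin.last m) (Fin.last m) = 1) (hBlast : B (Fin.last m) (Fin.last m) = 1)
    (h : ∀ i (j : Fin m), A i j.castSucc = B i j.castSucc) : A = B := by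
  have split : ∀ C : Matrix (Fin (m + 1)) (Fin (m + 1)) ℤ, IsSubringMatrix C →
      C (Fin.last m) (Fin.last m) = 1 → ∃ x : Fin m → ℤ, ∀ i,
        ∑ j, C i j.castSucc * x j + C i (Fin.last m) = 1 := by
    rintro C ⟨htri, -, -, ⟨x, hx⟩, -⟩ hC
    have hxl : x (Fin.last m) = 1 := by
      simpa [Matrix.mulVec, dotProduct, Fin.sum_univ_castSucc, hC,
        htri _ _ (Fin.castSucc_lt_last _)] using congrFun hx (Fin.last m)
    refine ⟨fun j => x j.castSucc, fun i => ?_⟩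
    simpa [Matrix.mulVec, dotProduct, Fin.sum_univ_castSucc, hxl] using congrFun hx i
  obtain ⟨x, hx⟩ := split A hA hAlast
  obtain ⟨y, hy⟩ := split B hB hBlast
  have hzero : (fun i => A i (Fin.last m) - B i (Fin.last m)) = 0 := by
    refine eq_zero_of_inColSpan hA.1
      ⟨Fin.snoc (α := fun _ => ℤ) (fun j => y j - x j) 0, ?_⟩ fun i => ?_
    · ext i
      have hyi := hy i
      simp only [← h] at hyi
      simp only [Matrix.mulVec, dotProduct, Fin.sum_univ_castSucc, Fin.snoc_castSucc,
        Fin.snoc_last, mul_sub, Finset.sum_sub_distrib]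
      linarith [hx i]
    · induction i using Fin.lastCases with
      | last => simp [hAlast, hBlast]
      | cast i =>
        have h1 := hA.2.2.1 _ _ (Fin.castSucc_lt_last i)
        have h2 := hB.2.2.1 _ _ (Fin.castSucc_lt_last i)
        rw [← h] at h2
        rw [abs_lt]
        constructor <;> linarith
  ext i j
  induction j using Fin.lastCases with
  | last => exact sub_eq_zero.mp (congrFun hzero i)
  | cast j => exact h i j

lemma finite_isIrreducibleSubringMatrix (p : ℕ) {m : ℕ} (α : Fin m → ℕ) :
    Finite {A : Matrix (Fin (m + 1)) (Fin (m + 1)) ℤ // IsIrreducibleSubringMatrix p α A} := by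
  let D : Fin (m + 1) → ℤ := Fin.snoc (α := fun _ => ℤ) (fun i => (p : ℤ) ^ α i) 1
  have hfin : (Set.Icc (0 : Fin (m + 1) → Fin (m + 1) → ℤ) fun i _ => D i).Finite :=
    Set.finite_Icc _ _
  refine Set.Finite.subset hfin ?_
  rintro A ⟨⟨htri, hpos, hbd, -, -⟩, hdiag, hlast, -, -⟩
  have hD : ∀ i, A i i = D i := by
    intro i
    induction i using Fin.lastCases with
    | last => simp [D, hlast]
    | cast i => simp [D, hdiag]
  have key : ∀ i j, 0 ≤ A i j ∧ A i j ≤ D i := by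
    intro i j
    rw [← hD]
    rcases lt_trichotomy i j with h | rfl | h
    · exact ⟨(hbd i j h).1, (hbd i j h).2.le⟩
    · exact ⟨(hpos i).le, le_rfl⟩
    · rw [htri i j h]
      exact ⟨le_rfl, (hpos i).le⟩
  exact ⟨fun i j => (key i j).1, fun i j => (key i j).2⟩

lemma pow_mul_card_le_gComp {p k : ℕ} (hp : 1 < p) {β : Fin (k + 1) → ℕ}
    (hpos : ∀ i, 1 ≤ β i) (hfirst : 2 ≤ β 0) :
    p ^ k *
        Nat.card {A : Matrix (Fin (k + 2)) (Fin (k + 2)) ℤ //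
          IsSubringMatrix A ∧
          (∀ i : Fin (k + 1), A i.castSucc i.castSucc =
            (p : ℤ) ^ (if i.val = 0 then β i - 2 else β i - 1)) ∧
          A (Fin.last (k + 1)) (Fin.last (k + 1)) = 1}
      ≤ gComp p β := by
  have hcard : p ^ k = Nat.card (Fin k → Fin p) := by simp
  rw [hcard, ← Nat.card_prod, gComp]
  have := finite_isIrreducibleSubringMatrix p β
  let d : (Fin k → Fin p) → Fin (k + 1) → ℤ := fun c => Fin.cons ((p : ℤ) - 1) fun j => (c j : ℤ)
  have hd : ∀ c i, 0 ≤ d c i ∧ d c i < p := by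
    intro c i
    induction i using Fin.cases with
    | zero => simp only [d, Fin.cons_zero]; omega
    | succ i => simp only [d, Fin.cons_succ]; have := (c i).isLt; omega
  refine Nat.card_le_card_of_injective
    (fun x => ⟨shiftMatrix (p : ℤ) (d x.1) x.2.1,
      isIrreducibleSubringMatrix_shiftMatrix hp hpos hfirst (by simp [d]) (hd x.1)
        x.2.2.1 x.2.2.2.1 x.2.2.2.2⟩) ?_
  rintro ⟨c, A, hA, hAdiag, hAlast⟩ ⟨c', B, hB, hBdiag, hBlast⟩ heq
  have heq' : ∀ i (j : Fin (k + 1)),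
      A i j.castSucc + d c j * A i 0 = B i j.castSucc + d c' j * B i 0 := by
    intro i j
    have h := congrFun (congrFun (Subtype.ext_iff.mp heq) i) j.castSucc
    simp only [shiftMatrix_castSucc] at h
    exact mul_left_cancel₀ (by omega) h
  have h00 : A 0 0 = B 0 0 := (hAdiag 0).trans (hBdiag 0).symm
  have hcol0 : ∀ i, A i 0 = B i 0 := by
    intro i
    rcases eq_or_ne i 0 with rfl | hi
    · exact h00
    · rw [hA.1 _ _ (Fin.pos_of_ne_zero hi), hB.1 _ _ (Fin.pos_of_ne_zero hi)]
  have hc : c = c' := by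
    ext j
    have h := heq' 0 j.succ
    have h1 := hA.2.2.1 0 j.succ.castSucc (by simp [Fin.lt_def])
    have h2 := hB.2.2.1 0 j.succ.castSucc (by simp [Fin.lt_def])
    rw [← h00] at h h2
    simp only [d, Fin.cons_succ] at h
    have hdvd : A 0 0 ∣ A 0 j.succ.castSucc - B 0 j.succ.castSucc :=
      ⟨(c' j : ℤ) - c j, by linarith⟩
    have hz := Int.eq_zero_of_abs_lt_dvd hdvd (by rw [abs_lt]; constructor <;> linarith)
    have : (c j : ℤ) * A 0 0 = c' j * A 0 0 := by linarith
    exact_mod_cast mul_right_cancel₀ (hA.2.1 0).ne' this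
  subst hc
  have hAB : A = B := hA.ext_of_castSucc hB hAlast hBlast fun i j => by
    have h := heq' i j
    rw [hcol0 i] at h
    exact add_right_cancel h
  subst hAB
  rfl

theorem g_lower_bound_shift (p : ℕ) (hp : p.Prime) (n : ℕ) (hn : 2 ≤ n)
    (β : Fin (n - 1) → ℕ) (hpos : ∀ i, 1 ≤ β i) (hfirst : 2 ≤ β ⟨0, by omega⟩)
    (hsum : n < ∑ i, β i) :
    p ^ (n - 2) *
        Nat.card {A : Matrix (Fin (n - 1 + 1)) (Fin (n - 1 + 1)) ℤ //
          IsSubringMatrix A ∧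
          (∀ i : Fin (n - 1), A i.castSucc i.castSucc =
            (p : ℤ) ^ (if i.val = 0 then β i - 2 else β i - 1)) ∧
          A (Fin.last (n - 1)) (Fin.last (n - 1)) = 1}
      ≤ gComp p β := by
  obtain ⟨k, rfl⟩ := Nat.exists_eq_add_of_le' hn
  exact pow_mul_card_le_gComp (k := k) hp.one_lt hpos hfirst
end

section
/- Let p be a prime, n ≥ 4 an integer, and let β, γ be integers with β ≥ 3 and γ ≥ β − 1. Let α = (β, 1, …, 1, γ) be the composition of length n−1 whose first entry is β, whose last entry is γ, and all of whose other entries equal 1. Then g_α(p) = p^{n−3+⌊β/2⌋} + (n−3)·p^{n−2}. -/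
/-- The upper-triangular matrix with diagonal `(d, 1)` whose only further nonzero entries are
`c` in the first row and ones in the last column. -/
def firstRowMatrix {k : ℕ} (d : Fin (k + 1) → ℤ) (c : Fin k → ℤ) :
    Matrix (Fin (k + 2)) (Fin (k + 2)) ℤ := fun i j =>
  Fin.lastCases (motive := fun _ => ℤ) 1 (fun j' => Fin.lastCases (motive := fun _ => ℤ) 0
    (fun i' => Fin.cases (motive := fun _ => ℤ) (Fin.cases (motive := fun _ => ℤ) (d 0) c j')
      (fun i'' => if j' = i''.succ then d j' else 0) i') i) j

namespace firstRowMatrix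

variable {k : ℕ} (d : Fin (k + 1) → ℤ) (c : Fin k → ℤ)

@[simp] lemma apply_last (i : Fin (k + 2)) : firstRowMatrix d c i (Fin.last _) = 1 := by
  simp [firstRowMatrix]

@[simp] lemma last_apply (j : Fin (k + 1)) :
    firstRowMatrix d c (Fin.last _) j.castSucc = 0 := by
  simp [firstRowMatrix]

@[simp] lemma last_zero : firstRowMatrix d c (Fin.last _) 0 = 0 :=
  last_apply d c 0

@[simp] lemma zero_zero : firstRowMatrix d c 0 0 = d 0 := by
  rw [← Fin.castSucc_zero]
  simp only [firstRowMatrix, Fin.lastCases_castSucc, Fin.cases_zero]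

@[simp] lemma zero_succ (j : Fin k) : firstRowMatrix d c 0 j.succ.castSucc = c j := by
  rw [← Fin.castSucc_zero]
  simp only [firstRowMatrix, Fin.lastCases_castSucc, Fin.cases_zero, Fin.cases_succ]

@[simp] lemma succ_zero (i : Fin k) : firstRowMatrix d c i.succ.castSucc 0 = 0 := by
  rw [← Fin.castSucc_zero]
  simp only [firstRowMatrix, Fin.lastCases_castSucc, Fin.cases_succ]
  simp [(Fin.succ_ne_zero i).symm]

@[simp] lemma succ_succ (i j : Fin k) :
    firstRowMatrix d c i.succ.castSucc j.succ.castSucc = if j = i then d j.succ else 0 := by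
  simp [firstRowMatrix, -Fin.castSucc_succ]

lemma injective : Function.Injective (firstRowMatrix d) := fun c c' h => by
  ext j
  simpa [-Fin.castSucc_succ] using congrFun (congrFun h 0) j.succ.castSucc

lemma inColSpan_iff (v : Fin (k + 2) → ℤ) :
    InColSpan (firstRowMatrix d c) v ↔ ∃ y : Fin k → ℤ,
      (∀ i, v i.succ.castSucc = d i.succ * y i + v (Fin.last _)) ∧
      d 0 ∣ v 0 - v (Fin.last _) - ∑ i, c i * y i := by
  constructor
  · rintro ⟨x, rfl⟩
    refine ⟨fun i => x i.succ.castSucc, fun i => ?_, x 0, ?_⟩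
    · simp [Matrix.mulVec, dotProduct, Fin.sum_univ_castSucc (n := k + 1), Fin.sum_univ_succ,
        -Fin.castSucc_succ]
    · simp [Matrix.mulVec, dotProduct, Fin.sum_univ_castSucc (n := k + 1), Fin.sum_univ_succ,
        -Fin.castSucc_succ]
  · rintro ⟨y, hy, z, hz⟩
    refine ⟨Fin.lastCases (v (Fin.last _)) (Fin.cases z y), funext fun i => ?_⟩
    induction i using Fin.lastCases with
    | last =>
      simp [Matrix.mulVec, dotProduct, Fin.sum_univ_castSucc (n := k + 1)]
    | cast i =>
      induction i using Fin.cases with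
      | zero =>
        simp [Matrix.mulVec, dotProduct, Fin.sum_univ_castSucc (n := k + 1), Fin.sum_univ_succ,
          -Fin.castSucc_succ]
        linarith
      | succ i =>
        simp [Matrix.mulVec, dotProduct, Fin.sum_univ_castSucc (n := k + 1), Fin.sum_univ_succ,
          -Fin.castSucc_succ, hy]

lemma inColSpan_mul_iff (hd : ∀ i, d i ≠ 0) :
    (∀ j l, InColSpan (firstRowMatrix d c)
      (fun i => firstRowMatrix d c i j * firstRowMatrix d c i l)) ↔
    (∀ i j, i ≠ j → d 0 ∣ c i * c j) ∧ ∀ j, d 0 ∣ c j ^ 2 - d j.succ * c j := by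
  constructor
  · refine fun h => ⟨fun i j hij => ?_, fun j => ?_⟩
    · obtain ⟨y, hy, hdvd⟩ := (inColSpan_iff d c _).1 (h i.succ.castSucc j.succ.castSucc)
      have hy0 : ∀ l, y l = 0 := fun l => by
        have := hy l
        have hl : ¬ (i = l ∧ j = l) := fun ⟨h1, h2⟩ => hij (h1.trans h2.symm)
        simp only [succ_succ, last_apply, mul_zero, add_zero, ite_mul, mul_ite, zero_mul] at this
        have : d l.succ * y l = 0 := by rw [← this]; split_ifs <;> simp_all
        exact (mul_eq_zero.1 this).resolve_left (hd _)
      simpa [-Fin.castSucc_succ, hy0] using hdvd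
    · obtain ⟨y, hy, hdvd⟩ := (inColSpan_iff d c _).1 (h j.succ.castSucc j.succ.castSucc)
      have hy0 : ∀ l, y l = if j = l then d j.succ else 0 := fun l => by
        have := hy l
        simp only [succ_succ, last_apply, mul_zero, add_zero] at this
        apply mul_left_cancel₀ (hd l.succ)
        rw [← this]
        split_ifs <;> simp_all
      simp [-Fin.castSucc_succ, hy0] at hdvd
      convert hdvd using 1
      ring
  · rintro ⟨hne, hsq⟩ j l
    have hcol : ∀ j, InColSpan (firstRowMatrix d c) (fun i => firstRowMatrix d c i j) :=
      fun j => ⟨Pi.single j 1, by ext; simp⟩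
    induction j using Fin.lastCases with
    | last => simpa using hcol l
    | cast j =>
      induction l using Fin.lastCases with
      | last => simpa [-Fin.castSucc_succ] using hcol j.castSucc
      | cast l =>
        rw [inColSpan_iff]
        induction j using Fin.cases with
        | zero =>
          refine ⟨0, ?_, ?_⟩ <;> simp [-Fin.castSucc_succ]
        | succ j =>
          induction l using Fin.cases with
          | zero =>
            refine ⟨0, ?_, ?_⟩ <;> simp [-Fin.castSucc_succ]
          | succ l =>
            by_cases hjl : j = l
            · subst hjl
              refine ⟨fun i => if j = i then d j.succ else 0, fun i => ?_, ?_⟩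
              · simp only [succ_succ, last_apply, mul_zero, add_zero]
                split_ifs <;> simp_all
              · have := hsq j
                simp [-Fin.castSucc_succ]
                convert this using 1
                ring
            · refine ⟨0, fun i => ?_, ?_⟩
              · simp only [succ_succ, last_apply, mul_zero, add_zero, Pi.zero_apply]
                split_ifs <;> simp_all
              · simpa [-Fin.castSucc_succ] using hne j l hjl

end firstRowMatrix

/-- If all middle diagonal exponents equal one, then an irreducible subring matrix is determined
by its first row. -/
lemma isIrreducibleSubringMatrix_iff {p : ℕ} (hp : p.Prime) {k : ℕ} {α : Fin (k + 1) → ℕ}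
    (hα : ∀ i, 1 ≤ α i) (hone : ∀ i j : Fin k, i < j → α i.succ = 1)
    (A : Matrix (Fin (k + 2)) (Fin (k + 2)) ℤ) :
    IsIrreducibleSubringMatrix p α A ↔ ∃ c : Fin k → ℤ,
      ((∀ j, 0 ≤ c j ∧ c j < (p : ℤ) ^ α 0 ∧ (p : ℤ) ∣ c j) ∧
        (∀ i j, i ≠ j → (p : ℤ) ^ α 0 ∣ c i * c j) ∧
        ∀ j, (p : ℤ) ^ α 0 ∣ c j ^ 2 - (p : ℤ) ^ α j.succ * c j) ∧
      firstRowMatrix (fun i => (p : ℤ) ^ α i) c = A := by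
  have hp1 : (1 : ℤ) < p := by exact_mod_cast hp.one_lt
  have hd : ∀ i, (p : ℤ) ^ α i ≠ 0 := fun i => by positivity
  constructor
  · rintro ⟨⟨hlow, hpos, hhnf, hspan, hmul⟩, hdiag, hlast, hcol, hdvd⟩
    have hA : firstRowMatrix (fun i => (p : ℤ) ^ α i) (fun j => A 0 j.succ.castSucc) = A := by
      ext i j
      induction j using Fin.lastCases with
      | last => simp [hcol]
      | cast j =>
        induction i using Fin.lastCases with
        | last => simpa using (hlow _ _ (Fin.castSucc_lt_last j)).symm
        | cast i =>
          induction i using Fin.cases with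
          | zero =>
            induction j using Fin.cases with
            | zero => simpa using (hdiag 0).symm
            | succ j => simp [-Fin.castSucc_succ]
          | succ i =>
            induction j using Fin.cases with
            | zero =>
              simpa [-Fin.castSucc_succ] using
                (hlow i.succ.castSucc (Fin.castSucc 0) (by simp [Fin.lt_def])).symm
            | succ j =>
              rcases lt_trichotomy i j with h | rfl | h
              · have hij : i.succ < j.succ := Fin.succ_lt_succ_iff.2 h
                have hb := hhnf i.succ.castSucc j.succ.castSucc (Fin.castSucc_lt_castSucc_iff.2 hij)
                rw [hdiag, hone i j h, pow_one] at hb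
                rw [Int.eq_zero_of_dvd_of_nonneg_of_lt hb.1 hb.2 (hdvd _ _ hij)]
                simp [-Fin.castSucc_succ, h.ne']
              · simp [-Fin.castSucc_succ, hdiag]
              · rw [hlow _ _ (Fin.castSucc_lt_castSucc_iff.2 (Fin.succ_lt_succ_iff.2 h))]
                simp [-Fin.castSucc_succ, h.ne]
    refine ⟨_, ⟨fun j => ?_, ?_⟩, hA⟩
    · have hb := hhnf (Fin.castSucc 0) j.succ.castSucc (by simp [Fin.lt_def])
      rw [hdiag] at hb
      exact ⟨hb.1, hb.2, hdvd 0 j.succ (Fin.succ_pos j)⟩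
    · rw [← hA] at hmul
      exact (firstRowMatrix.inColSpan_mul_iff _ _ hd).1 hmul
  · rintro ⟨c, ⟨hc, hmul⟩, rfl⟩
    have hdiag : ∀ i : Fin (k + 1),
        firstRowMatrix (fun i => (p : ℤ) ^ α i) c i.castSucc i.castSucc = (p : ℤ) ^ α i := by
      intro i
      induction i using Fin.cases with
      | zero => simp
      | succ i => simp [-Fin.castSucc_succ]
    refine ⟨⟨?_, ?_, ?_, ?_, (firstRowMatrix.inColSpan_mul_iff _ _ hd).2 hmul⟩, hdiag, by simp,
      by simp, ?_⟩
    · intro i j hij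
      induction j using Fin.lastCases with
      | last => exact absurd hij (Fin.le_last i).not_gt
      | cast j =>
        induction i using Fin.lastCases with
        | last => simp
        | cast i =>
          induction i using Fin.cases with
          | zero => exact absurd hij (by simp)
          | succ i =>
            induction j using Fin.cases with
            | zero => simp [-Fin.castSucc_succ]
            | succ j =>
              have : j ≠ i := by
                rintro rfl
                exact lt_irrefl _ hij
              simp [-Fin.castSucc_succ, this]
    · intro i
      induction i using Fin.lastCases with
      | last => simp
      | cast i => rw [hdiag]; positivity
    · intro i j hij
      induction i using Fin.lastCases with
      | last => exact absurd hij (Fin.le_last j).not_gt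
      | cast i =>
        rw [hdiag]
        induction j using Fin.lastCases with
        | last =>
          have := hα i
          simpa using one_lt_pow₀ hp1 (by omega)
        | cast j =>
          induction j using Fin.cases with
          | zero => exact absurd hij (by simp)
          | succ j =>
            induction i using Fin.cases with
            | zero => simpa [-Fin.castSucc_succ] using ⟨(hc j).1, (hc j).2.1⟩
            | succ i =>
              have : j ≠ i := by
                rintro rfl
                exact lt_irrefl _ hij
              simp only [firstRowMatrix.succ_succ, if_neg this]
              exact ⟨le_rfl, by positivity⟩
    · exact ⟨Pi.single (Fin.last _) 1, by ext; simp⟩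
    · intro i j hij
      induction j using Fin.cases with
      | zero => exact absurd hij (by simp)
      | succ j =>
        induction i using Fin.cases with
        | zero => simpa [-Fin.castSucc_succ] using (hc j).2.2
        | succ i =>
          have : j ≠ i := by
            rintro rfl
            exact lt_irrefl _ hij
          simp [-Fin.castSucc_succ, this]

lemma card_filter_Ico_dvd_sub {d : ℕ} (hd : 0 < d) (e : ℕ) (r : ℤ) :
    ((Finset.Ico (0 : ℤ) (d * e)).filter (fun x => (d : ℤ) ∣ x - r)).card = e := by
  have h := Int.Ico_filter_modEq_card (0 : ℤ) (d * e) (r := (d : ℤ)) (by exact_mod_cast hd) r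
  have hd' : (d : ℚ) ≠ 0 := by positivity
  have h2 : (((d * e : ℤ) : ℚ) - r) / ((d : ℤ) : ℚ) = (((0 : ℤ) : ℚ) - r) / ((d : ℤ) : ℚ) + e := by
    push_cast
    field_simp
    ring
  rw [h2, Int.ceil_add_natCast] at h
  simp only [add_sub_cancel_left] at h
  rw [← Nat.cast_inj (R := ℤ), Finset.filter_congr (q := fun x => x ≡ r [ZMOD d]), h]
  · simp
  · exact fun x _ => by rw [Int.modEq_comm, Int.modEq_iff_dvd]

/-- If `q ^ (2 * h + 1)` divides a square, then `q ^ (h + 1)` divides the base. -/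
lemma Prime.pow_half_dvd_of_pow_dvd_sq {q : ℤ} (hq : Prime q) (h : ℕ) :
    ∀ {x : ℤ}, q ^ (2 * h + 1) ∣ x ^ 2 → q ^ (h + 1) ∣ x := by
  induction h with
  | zero =>
    intro x hx
    simpa using hq.dvd_of_dvd_pow (by simpa using hx)
  | succ h ih =>
    intro x hx
    obtain ⟨y, rfl⟩ := hq.dvd_of_dvd_pow ((dvd_pow_self q (by omega)).trans hx)
    rw [pow_succ', mul_dvd_mul_iff_left hq.ne_zero]
    apply ih
    rw [mul_pow, show 2 * (h + 1) + 1 = 2 + (2 * h + 1) by ring, pow_add] at hx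
    exact (mul_dvd_mul_iff_left (pow_ne_zero 2 hq.ne_zero)).1 hx

/-- The solutions of `x ^ 2 ≡ q x` modulo `q ^ (b + 2)` among multiples of `q`. -/
lemma Prime.pow_dvd_sq_sub_mul_iff {q : ℤ} (hq : Prime q) {b : ℕ} {x : ℤ} :
    q ∣ x ∧ q ^ (b + 2) ∣ x ^ 2 - q * x ↔ q ^ (b + 1) ∣ x ∨ q ^ (b + 1) ∣ x - q := by
  constructor
  · rintro ⟨⟨u, rfl⟩, h⟩
    have hu : q ^ b ∣ u * (u - 1) := by
      have : (q * u) ^ 2 - q * (q * u) = q ^ 2 * (u * (u - 1)) := by ring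
      rw [this, add_comm, pow_add] at h
      exact (mul_dvd_mul_iff_left (pow_ne_zero 2 hq.ne_zero)).1 h
    rw [show q * u - q = q * (u - 1) by ring, pow_succ', mul_dvd_mul_iff_left hq.ne_zero,
      mul_dvd_mul_iff_left hq.ne_zero]
    by_cases hqu : q ∣ u
    · refine .inl (hq.pow_dvd_of_dvd_mul_right b (fun h1 => hq.not_dvd_one ?_) hu)
      simpa using dvd_sub hqu h1
    · exact .inr (hq.pow_dvd_of_dvd_mul_left b hqu hu)
  · have hqb : q ∣ q ^ (b + 1) := dvd_pow_self q (by omega)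
    have key : x ^ 2 - q * x = x * (x - q) := by ring
    rw [key, show q ^ (b + 2) = q ^ (b + 1) * q from pow_succ q (b + 1)]
    rintro (h | h)
    · have hx := hqb.trans h
      exact ⟨hx, mul_dvd_mul h (dvd_sub_self_right.2 hx)⟩
    · have hx : q ∣ x := by simpa using hqb.trans h
      exact ⟨hx, by rw [mul_comm]; exact mul_dvd_mul hx h⟩

/-- Explicit form of the conditions on the first row. -/
lemma Prime.first_row_conditions_iff {q : ℤ} (hq : Prime q) {b γ m : ℕ} (hb : 1 ≤ b)
    (hγ : b + 1 ≤ γ) (c : Fin (m + 1) → ℤ) :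
    ((∀ j, q ∣ c j) ∧ (∀ i j, i ≠ j → q ^ (b + 2) ∣ c i * c j) ∧
      (∀ i : Fin m, q ^ (b + 2) ∣ c i.castSucc ^ 2 - q * c i.castSucc) ∧
      q ^ (b + 2) ∣ c (Fin.last m) ^ 2 - q ^ γ * c (Fin.last m)) ↔
    ((∀ i : Fin m, q ^ (b + 1) ∣ c i.castSucc) ∧ q ^ ((b + 3) / 2) ∣ c (Fin.last m)) ∨
      ∃ i : Fin m, q ^ (b + 1) ∣ c i.castSucc - q ∧ ∀ j, j ≠ i.castSucc → q ^ (b + 1) ∣ c j := by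
  have hqb : q ∣ q ^ (b + 1) := dvd_pow_self q (by omega)
  have hsucc : q ^ (b + 2) = q ^ (b + 1) * q := pow_succ q (b + 1)
  have hlast : ∀ {x : ℤ}, q ∣ x → (q ^ (b + 2) ∣ x ^ 2 - q ^ γ * x ↔ q ^ (b + 2) ∣ x ^ 2) := by
    intro x hx
    refine dvd_sub_left ?_
    rw [hsucc]
    exact mul_dvd_mul (pow_dvd_pow q hγ) hx
  constructor
  · rintro ⟨hdvd, hne, hmid, hl⟩
    have hmid' := fun i => hq.pow_dvd_sq_sub_mul_iff.1 ⟨hdvd _, hmid i⟩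
    by_cases hD : ∀ i : Fin m, q ^ (b + 1) ∣ c i.castSucc
    · refine .inl ⟨hD, ?_⟩
      rw [hlast (hdvd _)] at hl
      rw [show (b + 3) / 2 = (b + 1) / 2 + 1 by omega]
      exact hq.pow_half_dvd_of_pow_dvd_sq _ ((pow_dvd_pow q (by omega)).trans hl)
    · push Not at hD
      obtain ⟨i, hi⟩ := hD
      have hi' := (hmid' i).resolve_left hi
      refine .inr ⟨i, hi', fun j hj => ?_⟩
      obtain ⟨u, hu⟩ := hdvd i.castSucc
      have hqu : ¬ q ∣ u := by
        intro h
        rw [hu, show q * u - q = q * (u - 1) by ring, pow_succ',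
          mul_dvd_mul_iff_left hq.ne_zero] at hi'
        have h1 := (dvd_pow_self q (by omega : b ≠ 0)).trans hi'
        exact hq.not_dvd_one (by simpa using dvd_sub h h1)
      have hij := hne _ _ hj.symm
      rw [hu, mul_assoc, show q ^ (b + 2) = q * q ^ (b + 1) from pow_succ' q (b + 1),
        mul_dvd_mul_iff_left hq.ne_zero] at hij
      exact hq.pow_dvd_of_dvd_mul_left _ hqu hij
  · rintro (⟨hD, hl⟩ | ⟨i, hi, hD⟩)
    · have hdvd : ∀ j, q ∣ c j := by
        intro j
        induction j using Fin.lastCases with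
        | last => exact (dvd_pow_self q (by omega)).trans hl
        | cast j => exact hqb.trans (hD j)
      refine ⟨hdvd, fun i j hij => ?_, fun i => (hq.pow_dvd_sq_sub_mul_iff.2 (.inl (hD i))).2, ?_⟩
      · rw [hsucc]
        induction i using Fin.lastCases with
        | cast i => exact mul_dvd_mul (hD i) (hdvd j)
        | last =>
          induction j using Fin.lastCases with
          | cast j => rw [mul_comm]; exact mul_dvd_mul (hdvd _) (hD j)
          | last => exact absurd rfl hij
      · rw [hlast (hdvd _)]
        refine (pow_dvd_pow q (?_ : b + 2 ≤ (b + 3) / 2 * 2)).trans ?_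
        · omega
        · rw [pow_mul]
          exact pow_dvd_pow_of_dvd hl 2
    · have hdvd : ∀ j, q ∣ c j := by
        intro j
        by_cases hj : j = i.castSucc
        · subst hj
          simpa using hqb.trans hi
        · exact hqb.trans (hD j hj)
      refine ⟨hdvd, fun j l hjl => ?_, fun j => ?_, ?_⟩
      · rw [hsucc]
        by_cases hj : j = i.castSucc
        · subst hj
          rw [mul_comm (c _)]
          exact mul_dvd_mul (hD l hjl.symm) (hdvd _)
        · exact mul_dvd_mul (hD j hj) (hdvd _)
      · refine (hq.pow_dvd_sq_sub_mul_iff.2 ?_).2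
        by_cases hj : j = i
        · subst hj
          exact .inr hi
        · exact .inl (hD _ (by simpa using hj))
      · have h := hD (Fin.last m) (Fin.castSucc_lt_last i).ne'
        rw [hlast (hdvd _), hsucc, sq]
        exact mul_dvd_mul h (hdvd _)

/-- The residues `x` modulo `p ^ e` with `x ≡ r` modulo `p ^ t`. -/
noncomputable def residueFiber (p e t : ℕ) (r : ℤ) : Finset ℤ :=
  (Finset.Ico (0 : ℤ) (p ^ e)).filter (fun x => (p : ℤ) ^ t ∣ x - r)

lemma mem_residueFiber {p e t : ℕ} {r x : ℤ} :
    x ∈ residueFiber p e t r ↔ (0 ≤ x ∧ x < (p : ℤ) ^ e) ∧ (p : ℤ) ^ t ∣ x - r := by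
  simp [residueFiber]

lemma card_residueFiber {p e t : ℕ} (hp : 0 < p) (ht : t ≤ e) (r : ℤ) :
    (residueFiber p e t r).card = p ^ (e - t) := by
  have h := card_filter_Ico_dvd_sub (pow_pos hp t) (p ^ (e - t)) r
  rw [← Nat.cast_mul, ← pow_add, Nat.add_sub_cancel' ht] at h
  simpa [residueFiber] using h

/-- The admissible first rows with all middle entries divisible by `p ^ (b + 1)`. -/
noncomputable def nilpotentRows (p b m : ℕ) : Finset (Fin (m + 1) → ℤ) :=
  Fintype.piFinset fun j =>
    residueFiber p (b + 2) (if j = Fin.last m then (b + 3) / 2 else b + 1) 0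

/-- The admissible first rows whose `i`-th entry is congruent to `p` modulo `p ^ (b + 1)`. -/
noncomputable def idempotentRows (p b : ℕ) {m : ℕ} (i : Fin m) : Finset (Fin (m + 1) → ℤ) :=
  Fintype.piFinset fun j => residueFiber p (b + 2) (b + 1) (if j = i.castSucc then p else 0)

lemma card_nilpotentRows {p : ℕ} (hp : 0 < p) (b m : ℕ) :
    (nilpotentRows p b m).card = p ^ (m + (b + 2) / 2) := by
  rw [nilpotentRows, Fintype.card_piFinset, Fin.prod_univ_castSucc]
  simp only [if_true, (Fin.castSucc_lt_last _).ne, if_false]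
  rw [card_residueFiber hp (by omega), card_residueFiber hp (by omega),
    show b + 2 - (b + 3) / 2 = (b + 2) / 2 by omega, show b + 2 - (b + 1) = 1 by omega]
  simp [pow_add]

lemma card_idempotentRows {p : ℕ} (hp : 0 < p) (b : ℕ) {m : ℕ} (i : Fin m) :
    (idempotentRows p b i).card = p ^ (m + 1) := by
  rw [idempotentRows, Fintype.card_piFinset]
  simp [card_residueFiber hp (show b + 1 ≤ b + 2 by omega)]

lemma not_pow_dvd_and_pow_dvd_sub {p : ℕ} (hp : p.Prime) {b : ℕ} (hb : 1 ≤ b) {x : ℤ}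
    (h : (p : ℤ) ^ (b + 1) ∣ x) : ¬ (p : ℤ) ^ (b + 1) ∣ x - p := by
  intro h'
  have h1 : (p : ℤ) ^ (b + 1) ∣ p := (dvd_sub_right h).1 h'
  have h2 : p ^ (b + 1) ∣ p ^ 1 := by
    rw [pow_one]
    exact_mod_cast h1
  have := (Nat.pow_dvd_pow_iff_le_right hp.one_lt).1 h2
  omega

lemma card_nilpotentRows_union {p : ℕ} (hp : p.Prime) {b : ℕ} (hb : 1 ≤ b) (m : ℕ) :
    (nilpotentRows p b m ∪ Finset.univ.biUnion (idempotentRows p b (m := m))).card =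
      p ^ (m + (b + 2) / 2) + m * p ^ (m + 1) := by
  rw [Finset.card_union_of_disjoint, Finset.card_biUnion, card_nilpotentRows hp.pos]
  · simp [card_idempotentRows hp.pos]
  · intro i _ j _ hij
    rw [Function.onFun, Finset.disjoint_left]
    intro c hi hj
    have h1 := (mem_residueFiber.1 (Fintype.mem_piFinset.1 hi i.castSucc)).2
    have h2 := (mem_residueFiber.1 (Fintype.mem_piFinset.1 hj i.castSucc)).2
    rw [if_pos rfl] at h1
    rw [if_neg (by simpa using hij), sub_zero] at h2
    exact not_pow_dvd_and_pow_dvd_sub hp hb h2 h1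
  · rw [Finset.disjoint_biUnion_right]
    intro i _
    rw [Finset.disjoint_left]
    intro c h0 hi
    have h1 := (mem_residueFiber.1 (Fintype.mem_piFinset.1 hi i.castSucc)).2
    have h2 := (mem_residueFiber.1 (Fintype.mem_piFinset.1 h0 i.castSucc)).2
    rw [if_pos rfl] at h1
    rw [if_neg (Fin.castSucc_lt_last i).ne, sub_zero] at h2
    exact not_pow_dvd_and_pow_dvd_sub hp hb h2 h1

lemma mem_nilpotentRows_union_iff {p b m : ℕ} {c : Fin (m + 1) → ℤ} :
    c ∈ nilpotentRows p b m ∪ Finset.univ.biUnion (idempotentRows p b (m := m)) ↔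
      (∀ j, 0 ≤ c j ∧ c j < (p : ℤ) ^ (b + 2)) ∧
      (((∀ i : Fin m, (p : ℤ) ^ (b + 1) ∣ c i.castSucc) ∧
        (p : ℤ) ^ ((b + 3) / 2) ∣ c (Fin.last m)) ∨
      ∃ i : Fin m, (p : ℤ) ^ (b + 1) ∣ c i.castSucc - p ∧
        ∀ j, j ≠ i.castSucc → (p : ℤ) ^ (b + 1) ∣ c j) := by
  have h0 : c ∈ nilpotentRows p b m ↔ (∀ j, 0 ≤ c j ∧ c j < (p : ℤ) ^ (b + 2)) ∧
      ((∀ i : Fin m, (p : ℤ) ^ (b + 1) ∣ c i.castSucc) ∧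
        (p : ℤ) ^ ((b + 3) / 2) ∣ c (Fin.last m)) := by
    simp only [nilpotentRows, Fintype.mem_piFinset, mem_residueFiber]
    simp [forall_and, Fin.forall_fin_succ', (Fin.castSucc_lt_last _).ne]
  have hi : ∀ i, c ∈ idempotentRows p b i ↔ (∀ j, 0 ≤ c j ∧ c j < (p : ℤ) ^ (b + 2)) ∧
      (p : ℤ) ^ (b + 1) ∣ c i.castSucc - p ∧
        ∀ j, j ≠ i.castSucc → (p : ℤ) ^ (b + 1) ∣ c j := by
    intro i
    simp only [idempotentRows, Fintype.mem_piFinset, mem_residueFiber]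
    refine ⟨fun h => ⟨fun j => (h j).1, by simpa using (h i.castSucc).2, fun j hj => ?_⟩,
      fun h j => ⟨h.1 j, ?_⟩⟩
    · simpa [hj] using (h j).2
    · by_cases hj : j = i.castSucc
      · subst hj
        simpa using h.2.1
      · simpa [hj] using h.2.2 j hj
  simp only [Finset.mem_union, Finset.mem_biUnion, Finset.mem_univ, true_and, h0, hi,
    and_or_left, exists_and_left]

theorem g_beta_ones_gamma (p : ℕ) (hp : p.Prime) (n : ℕ) (hn : 4 ≤ n)
    (β γ : ℕ) (hβ : 3 ≤ β) (hγ : β - 1 ≤ γ) :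
    gComp p (fun i : Fin (n - 1) =>
        if i.val = 0 then β else if i.val = n - 2 then γ else 1) =
      p ^ (n - 3 + β / 2) + (n - 3) * p ^ (n - 2) := by
  obtain ⟨m, rfl⟩ : ∃ m, n = m + 3 := ⟨n - 3, by omega⟩
  obtain ⟨b, rfl⟩ : ∃ b, β = b + 2 := ⟨β - 2, by omega⟩
  have hb : 1 ≤ b := by omega
  have hγ' : b + 1 ≤ γ := by omega
  change gComp p (n := m + 1 + 1) (fun i => if i.val = 0 then b + 2 else
    if i.val = m + 1 then γ else 1) = p ^ (m + (b + 2) / 2) + m * p ^ (m + 1)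
  set α : Fin (m + 1 + 1) → ℕ := fun i => if i.val = 0 then b + 2 else
    if i.val = m + 1 then γ else 1 with hα
  have hα0 : α 0 = b + 2 := by simp [hα]
  have hαlast : α (Fin.last m).succ = γ := by simp [hα]
  have hαmid : ∀ i : Fin m, α i.castSucc.succ = 1 := fun i => by simp [hα, i.isLt.ne]
  have hpos : ∀ i, 1 ≤ α i := fun i => by
    simp only [hα]
    split_ifs <;> omega
  have hone : ∀ i j : Fin (m + 1), i < j → α i.succ = 1 := fun i j hij => by
    have : i.val ≠ m := by omega
    simp [hα, this]
  rw [← card_nilpotentRows_union hp hb, gComp, ← Set.ncard_coe_finset,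
    ← Set.ncard_image_of_injective _ (firstRowMatrix.injective fun i => (p : ℤ) ^ α i),
    ← Nat.card_coe_set_eq]
  refine Nat.card_congr (Equiv.subtypeEquivRight fun A => ?_)
  rw [isIrreducibleSubringMatrix_iff hp hpos hone, Set.mem_image]
  refine exists_congr fun c => and_congr_left fun _ => ?_
  rw [Finset.mem_coe, mem_nilpotentRows_union_iff,
    ← (Nat.prime_iff_prime_int.1 hp).first_row_conditions_iff hb hγ',
    Fin.forall_fin_succ' (P := fun j => _ ∣ c j ^ 2 - _ * c j)]
  simp only [hα0, hαlast, hαmid, pow_one]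
  constructor
  · exact fun ⟨h1, h2⟩ => ⟨fun j => ⟨(h1 j).1, (h1 j).2.1⟩, fun j => (h1 j).2.2, h2⟩
  · exact fun ⟨h1, h2, h3⟩ => ⟨fun j => ⟨(h1 j).1, (h1 j).2, h2 j⟩, h3⟩
end
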